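/- Let a, b, c, μ ∈ ℂ with Re c > 0 and Re μ > 0, and assume neither c nor c+μ is a nonpositive integer. Then for every real x ∈ (-∞,0) ∪ (0,1), one has ∫_I |y|^{c-1} (1-y)^{b-c-μ} F(a,b;c;y) · |x-y|^{μ-1}/Γ(μ) dy = (Γ(c)/Γ(c+μ)) · |x|^{c+μ-1} (1-x)^{b-c} · F(a+μ,b;c+μ;x), where I is the open interval with endpoints 0 and x (fractional integral transformation of type a+, c+). -/

import Mathlib

open MeasureTheory Set Complex Filter

/-- Pochhammer symbol `(a)_k = a (a+1) ⋯ (a+k-1)`. -/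
noncomputable def poch (a : ℂ) (k : ℕ) : ℂ := ∏ i ∈ Finset.range k, (a + i)

/-- The Gauss hypergeometric function `F(a,b;c;x)` for real `x < 1`, defined by the
power series on `[0,1)` and by the (agreeing) Pfaff series for `x < 0`. -/
noncomputable def hypF (a b c : ℂ) (x : ℝ) : ℂ :=
  if 0 ≤ x then
    ∑' k : ℕ, poch a k * poch b k / (poch c k * (Nat.factorial k : ℂ)) * (x : ℂ) ^ k
  else
    ((1 - x : ℝ) : ℂ) ^ (-a) *
      ∑' k : ℕ, poch a k * poch (c - b) k / (poch c k * (Nat.factorial k : ℂ)) *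
        (((x / (x - 1) : ℝ)) : ℂ) ^ k

lemma poch_zero (a : ℂ) : poch a 0 = 1 := by simp [poch]

lemma poch_succ (a : ℂ) (k : ℕ) : poch a (k + 1) = poch a k * (a + k) := by
  simp [poch, Finset.prod_range_succ]

lemma poch_ne_zero {c : ℂ} (h : ∀ n : ℕ, c ≠ -(n : ℂ)) (k : ℕ) : poch c k ≠ 0 := by
  rw [poch, Finset.prod_ne_zero_iff]
  intro i _ h0
  exact h i (eq_neg_of_add_eq_zero_left h0)

lemma poch_add (b : ℂ) (k j : ℕ) : poch b (k + j) = poch b k * poch (b + k) j := by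
  induction j with
  | zero => simp [poch_zero]
  | succ j ih =>
    rw [← add_assoc, poch_succ, ih, poch_succ]
    push_cast; ring

lemma poch_one (n : ℕ) : poch 1 n = (n.factorial : ℂ) := by
  induction n with
  | zero => simp [poch_zero]
  | succ n ih => rw [poch_succ, ih, Nat.factorial_succ]; push_cast; ring

lemma Gamma_add_nat {c : ℂ} (h : ∀ n : ℕ, c ≠ -(n : ℂ)) (n : ℕ) :
    Complex.Gamma (c + n) = poch c n * Complex.Gamma c := by
  induction n with
  | zero => simp [poch_zero]
  | succ n ih =>
    have : c + n ≠ 0 := fun h0 => h n (eq_neg_of_add_eq_zero_left h0)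
    push_cast
    rw [← add_assoc, Complex.Gamma_add_one _ this, ih, poch_succ]
    ring

lemma poch_vandermonde (a m : ℂ) (n : ℕ) :
    ∑ p ∈ Finset.HasAntidiagonal.antidiagonal n, (n.choose p.1 : ℂ) * (poch a p.1 * poch m p.2)
      = poch (a + m) n := by
  induction n with
  | zero => simp [poch_zero]
  | succ n ih =>
    rw [Finset.sum_antidiagonal_choose_succ_mul (fun i j => poch a i * poch m j), poch_succ, ← ih,
      Finset.sum_mul, ← Finset.sum_add_distrib]
    refine Finset.sum_congr rfl fun p hp => ?_
    have hpn := Finset.HasAntidiagonal.mem_antidiagonal.1 hp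
    have hch : n.choose p.2 = n.choose p.1 := by
      rw [← hpn, Nat.choose_symm_add]
    rw [hch, poch_succ, poch_succ, ← hpn]
    push_cast
    ring

lemma poch_saalschutz (A B C : ℂ) (h : ∀ n : ℕ, C ≠ -(n : ℂ)) (n : ℕ) :
    ∑ k ∈ Finset.range (n + 1), (n.choose k : ℂ) *
      (poch A k * poch B k / poch C k * poch (C - A - B) (n - k))
      = poch (C - A) n * poch (C - B) n / poch C n := by
  have hC : ∀ n, poch C n ≠ 0 := poch_ne_zero h
  have hC' : ∀ n : ℕ, C + n ≠ 0 := fun n h0 => h n (eq_neg_of_add_eq_zero_left h0)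
  induction n with
  | zero => simp [poch_zero]
  | succ n ih =>
    set e := C - A - B with he
    let G : ℕ → ℂ := fun k => match k with
      | 0 => 0
      | k + 1 => - (n.choose k : ℂ) * (poch A (k+1) * poch B (k+1) / poch C k * poch e (n - k))
    have key : ∀ k ∈ Finset.range (n + 2), (C + n) * (((n+1).choose k : ℂ) *
        (poch A k * poch B k / poch C k * poch e (n + 1 - k)))
        - (C - A + n) * (C - B + n) * ((n.choose k : ℂ) *
        (poch A k * poch B k / poch C k * poch e (n - k))) = G (k + 1) - G k := by
      intro k hk
      rcases k with _ | k
      · simp only [G, poch_zero, poch_succ, Nat.choose_zero_right, Nat.sub_zero]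
        simp only [he]
        push_cast
        ring
      · have hk' : k ≤ n := by simp at hk; omega
        obtain ⟨m, rfl⟩ := Nat.exists_eq_add_of_le hk'
        rcases m with _ | m
        · simp only [G]
          have e1 : k + 0 + 1 - (k + 1) = 0 := by omega
          have e2 : k + 0 - (k + 1) = 0 := by omega
          have e3 : k + 0 - k = 0 := by omega
          rw [e1, e2, e3]
          simp only [add_zero, Nat.choose_self, Nat.choose_succ_self, poch_zero, poch_succ]
          have := hC k
          have := hC' k
          field_simp
          push_cast
          ring
        · simp only [G]
          have e1 : k + (m + 1) + 1 - (k + 1) = m + 1 := by omega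
          have e2 : k + (m + 1) - (k + 1) = m := by omega
          have e3 : k + (m + 1) - k = m + 1 := by omega
          rw [e1, e2, e3]
          have c1 : ((k + (m + 1) + 1).choose (k + 1) : ℂ)
              = (k + (m + 1)).choose k + (k + (m + 1)).choose (k + 1) := by
            rw [Nat.choose_succ_succ]; push_cast; rfl
          have c2 : ((k + (m + 1)).choose (k + 1) : ℂ) * (k + 1) = (k + (m + 1)).choose k * (m + 1) := by
            have := Nat.choose_succ_right_eq (k + (m + 1)) k
            rw [e3] at this
            exact_mod_cast this
          rw [c1]
          have hk1 : (k + 1 : ℂ) ≠ 0 := by exact_mod_cast Nat.succ_ne_zero k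
          have c3 : ((k + (m + 1)).choose (k + 1) : ℂ) = (k + (m + 1)).choose k * (m + 1) / (k + 1) := by
            rw [eq_div_iff hk1, c2]
          rw [c3]
          simp only [poch_succ]
          have := hC k
          have := hC' k
          have h2 := hC' (k + 1)
          push_cast at h2
          simp only [he]
          push_cast
          field_simp
          ring
    have hs := Finset.sum_congr rfl key
    rw [Finset.sum_range_sub G, Finset.sum_sub_distrib, ← Finset.mul_sum, ← Finset.mul_sum,
      Finset.sum_range_succ (fun k => (n.choose k : ℂ) *
        (poch A k * poch B k / poch C k * poch e (n - k))) (n + 1), ih] at hs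
    have g1 : G (n + 2) = 0 := by simp [G]
    have g0 : G 0 = 0 := rfl
    rw [g1, g0] at hs
    simp only [Nat.choose_succ_self, Nat.cast_zero, zero_mul, add_zero, sub_zero] at hs
    have h3 := hC' n
    have h4 := hC n
    have := eq_of_sub_eq_zero hs
    have h5 : ∑ k ∈ Finset.range (n + 2), ((n+1).choose k : ℂ) *
        (poch A k * poch B k / poch C k * poch e (n + 1 - k))
        = (C - A + n) * (C - B + n) * (poch (C - A) n * poch (C - B) n / poch C n) / (C + n) := by
      rw [eq_div_iff h3, ← this]; ring
    rw [h5]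
    simp only [poch_succ]
    field_simp

lemma ring_choose_poch (a : ℂ) (n : ℕ) :
    Ring.choose (a + n - 1) n = poch a n / (n.factorial : ℂ) := by
  have hf : (n.factorial : ℂ) ≠ 0 := by exact_mod_cast n.factorial_ne_zero
  rw [eq_div_iff hf, ← Ring.multichoose_eq, mul_comm, ← nsmul_eq_mul,
    Ring.factorial_nsmul_multichoose_eq_ascPochhammer, Polynomial.ascPochhammer_smeval_eq_eval]
  induction n with
  | zero => simp [poch_zero]
  | succ n ih =>
    rw [poch_succ, ascPochhammer_succ_eval, ih]
    exact_mod_cast n.factorial_ne_zero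

lemma hasSum_binom (β : ℂ) {z : ℂ} (hz : ‖z‖ < 1) :
    HasSum (fun n : ℕ => poch β n / (n.factorial : ℂ) * z ^ n) ((1 - z) ^ (-β)) := by
  have h := (one_div_one_sub_cpow_hasFPowerSeriesOnBall_zero β).hasSum (y := z)
    (by simpa [enorm_eq_nnnorm, ← NNReal.coe_lt_coe] using hz)
  simp only [FormalMultilinearSeries.ofScalars_apply_eq, ring_choose_poch, zero_add, one_div,
    smul_eq_mul] at h
  rw [cpow_neg]
  exact h

lemma poch_ratio_bound (a : ℂ) {c : ℂ} (h : ∀ n : ℕ, c ≠ -(n : ℂ)) {ρ : ℝ} (hρ : 1 < ρ) :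
    ∃ K : ℝ, 0 < K ∧ ∀ n, ‖poch a n / poch c n‖ ≤ K * ρ ^ n := by
  have hC' : ∀ n : ℕ, c + n ≠ 0 := fun n h0 => h n (eq_neg_of_add_eq_zero_left h0)
  have hρ0 : 0 < ρ := by linarith
  have hlim : ∃ N : ℕ, ∀ n : ℕ, N ≤ n → ‖a + n‖ ≤ ρ * ‖c + n‖ := by
    obtain ⟨N, hN⟩ := exists_nat_ge ((‖a‖ + ρ * ‖c‖) / (ρ - 1))
    refine ⟨N, fun n hn => ?_⟩
    have h1 : ‖a + n‖ ≤ ‖a‖ + n := by simpa using norm_add_le a (n : ℂ)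
    have h2 : (n : ℝ) ≤ ‖c + n‖ + ‖c‖ := by
      have := norm_sub_le (c + n) c
      simpa using this
    have h3 : ‖a‖ + ρ * ‖c‖ ≤ n * (ρ - 1) := by
      rw [← div_le_iff₀ (by linarith)]
      exact hN.trans (by exact_mod_cast hn)
    nlinarith
  obtain ⟨N, hN⟩ := hlim
  let K : ℝ := ∑ i ∈ Finset.range (N + 1), ‖poch a i / poch c i‖ / ρ ^ i + 1
  have hKi : ∀ i, i ≤ N → ‖poch a i / poch c i‖ ≤ K * ρ ^ i := by
    intro i hi
    rw [← div_le_iff₀ (by positivity)]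
    have := Finset.single_le_sum (f := fun i => ‖poch a i / poch c i‖ / ρ ^ i)
      (fun i _ => by positivity) (Finset.mem_range.2 (Nat.lt_succ_of_le hi))
    simp only [K]
    linarith
  refine ⟨K, by positivity, fun n => ?_⟩
  rcases le_total n N with hn | hn
  · exact hKi n hn
  · induction n, hn using Nat.le_induction with
    | base => exact hKi N le_rfl
    | succ n hn ih =>
      rw [poch_succ, poch_succ, mul_div_mul_comm, norm_mul, pow_succ, ← mul_assoc]
      refine mul_le_mul ih ?_ (norm_nonneg _) (by positivity)
      rw [norm_div, div_le_iff₀ (norm_pos_iff.2 (hC' n))]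
      exact hN n hn

lemma one_ne_neg_nat (n : ℕ) : (1 : ℂ) ≠ -(n : ℂ) := by
  intro h
  have := congrArg Complex.re h
  simp at this
  have h2 : (0:ℝ) ≤ n := Nat.cast_nonneg n
  linarith

lemma exists_rho {r : ℝ} (hr0 : 0 ≤ r) (hr : r < 1) : ∃ ρ : ℝ, 1 < ρ ∧ ρ ^ 2 * r < 1 := by
  have h1 : Tendsto (fun ρ : ℝ => ρ ^ 2 * r) (nhdsWithin 1 (Ioi 1)) (nhds (1 ^ 2 * r)) :=
    ((continuous_id.pow 2).mul continuous_const).continuousAt.tendsto.mono_left nhdsWithin_le_nhds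
  have h2 : ∀ᶠ ρ in nhdsWithin (1:ℝ) (Ioi 1), ρ ^ 2 * r < 1 :=
    h1.eventually_lt_const (by simpa using hr)
  obtain ⟨ρ, h3, h4⟩ := (h2.and self_mem_nhdsWithin).exists
  exact ⟨ρ, h4, h3⟩

/-- coefficients -/
noncomputable def hcoef (a b c : ℂ) (k : ℕ) : ℂ :=
  poch a k * poch b k / (poch c k * (Nat.factorial k : ℂ))

lemma hcoef_bound (a b : ℂ) {c : ℂ} (h : ∀ n : ℕ, c ≠ -(n : ℂ)) {ρ : ℝ} (hρ : 1 < ρ) :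
    ∃ K : ℝ, 0 < K ∧ ∀ n, ‖hcoef a b c n‖ ≤ K * (ρ ^ 2) ^ n := by
  obtain ⟨K, hK, h1⟩ := poch_ratio_bound a h hρ
  obtain ⟨L, hL, h2⟩ := poch_ratio_bound b one_ne_neg_nat hρ
  refine ⟨K * L, by positivity, fun n => ?_⟩
  have : hcoef a b c n = (poch a n / poch c n) * (poch b n / poch 1 n) := by
    rw [hcoef, poch_one, mul_div_mul_comm]
  rw [this, norm_mul]
  calc _ ≤ (K * ρ ^ n) * (L * ρ ^ n) :=
        mul_le_mul (h1 n) (h2 n) (norm_nonneg _) (by positivity)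
    _ = _ := by ring

lemma hcoef_summable (a b : ℂ) {c : ℂ} (h : ∀ n : ℕ, c ≠ -(n : ℂ)) {r : ℝ} (hr0 : 0 ≤ r)
    (hr : r < 1) : Summable (fun n => ‖hcoef a b c n‖ * r ^ n) := by
  obtain ⟨ρ, h1, h2⟩ := exists_rho hr0 hr
  obtain ⟨K, hK, hb⟩ := hcoef_bound a b h h1
  refine Summable.of_nonneg_of_le (fun n => by positivity) (fun n => ?_)
    ((summable_geometric_of_lt_one (by positivity) h2).mul_left K)
  calc _ ≤ K * (ρ ^ 2) ^ n * r ^ n := by gcongr; exact hb n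
    _ = _ := by rw [mul_pow]; ring

lemma euler_transf (A B C : ℂ) (h : ∀ n : ℕ, C ≠ -(n : ℂ)) {v : ℝ} (hv0 : 0 ≤ v) (hv : v < 1) :
    ∑' k, hcoef (C - A) (C - B) C k * (v : ℂ) ^ k
      = ((1 - v : ℝ) : ℂ) ^ (-(C - A - B)) * ∑' k, hcoef A B C k * (v : ℂ) ^ k := by
  have hvn : ‖(v : ℂ)‖ = v := by simp [abs_of_nonneg hv0]
  have hb := hasSum_binom (C - A - B) (z := (v : ℂ)) (by rw [hvn]; exact hv)
  have e1 : ((1 - v : ℝ) : ℂ) = 1 - (v : ℂ) := by push_cast; rfl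
  have s1 : Summable (fun k => ‖hcoef A B C k * (v : ℂ) ^ k‖) := by
    simpa [abs_of_nonneg hv0] using hcoef_summable A B h hv0 hv
  have s2 : Summable (fun n : ℕ => ‖poch (C - A - B) n / (n.factorial : ℂ) * (v : ℂ) ^ n‖) := by
    have := hcoef_summable 1 (C - A - B) one_ne_neg_nat hv0 hv
    refine this.congr fun n => ?_
    rw [norm_mul, norm_pow, hvn, hcoef, mul_div_mul_left _ _ (poch_ne_zero one_ne_neg_nat n)]
  rw [e1, ← hb.tsum_eq, mul_comm, tsum_mul_tsum_eq_tsum_sum_range_of_summable_norm s1 s2]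
  refine tsum_congr fun n => ?_
  have hf : (n.factorial : ℂ) ≠ 0 := by exact_mod_cast n.factorial_ne_zero
  have hs := poch_saalschutz A B C h n
  have : hcoef (C - A) (C - B) C n = (poch (C - A) n * poch (C - B) n / poch C n) / n.factorial := by
    rw [hcoef, div_div]
  rw [this, ← hs, Finset.sum_div, Finset.sum_mul]
  refine Finset.sum_congr rfl fun k hk => ?_
  have hk' : k ≤ n := by simp at hk; omega
  have hch : (n.choose k : ℂ) = n.factorial / (k.factorial * (n - k).factorial) := by
    rw [Nat.cast_choose ℂ hk']
  have hp : (v : ℂ) ^ n = (v : ℂ) ^ k * (v : ℂ) ^ (n - k) := by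
    rw [← pow_add, Nat.add_sub_cancel' hk']
  have hf1 : (k.factorial : ℂ) ≠ 0 := by exact_mod_cast k.factorial_ne_zero
  have hf2 : ((n-k).factorial : ℂ) ≠ 0 := by exact_mod_cast (n-k).factorial_ne_zero
  have := poch_ne_zero h k
  rw [hch, hp, hcoef]
  field_simp

lemma antidiag_hasSum {f : ℕ × ℕ → ℂ} {M : ℕ → ℝ} (hM : Summable M)
    (hf : ∀ n, ∑ p ∈ Finset.HasAntidiagonal.antidiagonal n, ‖f p‖ ≤ M n) :
    ∑' k, ∑' j, f (k, j) = ∑' n, ∑ p ∈ Finset.HasAntidiagonal.antidiagonal n, f p ∧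
      Summable f := by
  have hs : Summable (fun x : (Σ n : ℕ, Finset.HasAntidiagonal.antidiagonal n) =>
      ‖f x.2‖) := by
    rw [summable_sigma_of_nonneg (fun _ => norm_nonneg _)]
    refine ⟨fun n => (hasSum_fintype _).summable, ?_⟩
    refine Summable.of_nonneg_of_le (fun n => tsum_nonneg fun _ => norm_nonneg _) (fun n => ?_) hM
    rw [tsum_fintype]
    have := Finset.sum_coe_sort (Finset.HasAntidiagonal.antidiagonal n) (fun p => ‖f p‖)
    rw [this]
    exact hf n
  have hs' : Summable (fun x : (Σ n : ℕ, Finset.HasAntidiagonal.antidiagonal n) => f x.2) :=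
    hs.of_norm
  have hsf : Summable f :=
    Finset.HasAntidiagonal.sigmaAntidiagonalEquivProd.summable_iff.1 hs'
  refine ⟨?_, hsf⟩
  rw [← hsf.tsum_prod, ← Finset.HasAntidiagonal.sigmaAntidiagonalEquivProd.tsum_eq f]
  have := hs'.tsum_sigma
  refine this.trans (tsum_congr fun n => ?_)
  rw [tsum_fintype]
  exact Finset.sum_coe_sort (Finset.HasAntidiagonal.antidiagonal n) f

lemma norm_P_le {a c : ℂ} {K ρ : ℝ} (hK : 0 < K) (hρ : 1 < ρ)
    (hb : ∀ n, ‖poch a n / poch c n‖ ≤ K * ρ ^ n) {s : ℝ} (hs0 : 0 < s) (hs1 : s < 1) (n : ℕ) :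
    ∑ p ∈ Finset.HasAntidiagonal.antidiagonal n,
      ‖(n.choose p.1 : ℂ) * (poch a p.1 / poch c p.1) * ((1 - s : ℂ) ^ p.1 * (s : ℂ) ^ p.2)‖
      ≤ K * ρ ^ n := by
  have h1s : ‖(1 - s : ℂ)‖ = 1 - s := by
    rw [← Complex.ofReal_one, ← Complex.ofReal_sub, Complex.norm_real, Real.norm_eq_abs,
      abs_of_pos (by linarith)]
  have hs : ‖(s : ℂ)‖ = s := by simp [abs_of_pos hs0]
  have hbin : ∑ p ∈ Finset.HasAntidiagonal.antidiagonal n,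
      (n.choose p.1 : ℝ) * ((1 - s) ^ p.1 * s ^ p.2) = 1 := by
    have := (Commute.all (1 - s) s).add_pow' n
    rw [sub_add_cancel, one_pow] at this
    simpa using this.symm
  calc _ ≤ ∑ p ∈ Finset.HasAntidiagonal.antidiagonal n,
      (K * ρ ^ n) * ((n.choose p.1 : ℝ) * ((1 - s) ^ p.1 * s ^ p.2)) := by
        refine Finset.sum_le_sum fun p hp => ?_
        have hpn := Finset.HasAntidiagonal.mem_antidiagonal.1 hp
        rw [norm_mul, norm_mul, norm_mul, norm_pow, norm_pow, h1s, hs, Complex.norm_natCast]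
        have h2 : ‖poch a p.1 / poch c p.1‖ ≤ K * ρ ^ n :=
          (hb p.1).trans (mul_le_mul_of_nonneg_left
            (pow_le_pow_right₀ hρ.le (by omega)) hK.le)
        have h3 : 0 ≤ 1 - s := by linarith
        calc _ ≤ (n.choose p.1 : ℝ) * (K * ρ ^ n) * ((1 - s) ^ p.1 * s ^ p.2) := by gcongr
          _ = _ := by ring
    _ = _ := by rw [← Finset.mul_sum, hbin, mul_one]

/-- summand of the regrouped double series -/
noncomputable def Qser (a b c : ℂ) (x : ℝ) (n : ℕ) (s : ℝ) : ℂ :=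
  poch b n / (n.factorial : ℂ) * (x : ℂ) ^ n *
    ∑ p ∈ Finset.HasAntidiagonal.antidiagonal n,
      (n.choose p.1 : ℂ) * (poch a p.1 / poch c p.1) * ((1 - s : ℂ) ^ p.1 * (s : ℂ) ^ p.2)

lemma Qser_bound (a b : ℂ) {c : ℂ} (h : ∀ n : ℕ, c ≠ -(n : ℂ)) {x : ℝ} (hx0 : 0 < x)
    (hx1 : x < 1) : ∃ M : ℕ → ℝ, Summable M ∧ ∀ s : ℝ, 0 < s → s < 1 → ∀ n,
      ‖poch b n / (n.factorial : ℂ) * (x : ℂ) ^ n‖ *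
      ∑ p ∈ Finset.HasAntidiagonal.antidiagonal n,
      ‖(n.choose p.1 : ℂ) * (poch a p.1 / poch c p.1) * ((1 - s : ℂ) ^ p.1 * (s : ℂ) ^ p.2)‖
        ≤ M n := by
  obtain ⟨ρ, h1, h2⟩ := exists_rho hx0.le hx1
  obtain ⟨K, hK, hb⟩ := poch_ratio_bound a h h1
  obtain ⟨L, hL, hb2⟩ := poch_ratio_bound b one_ne_neg_nat h1
  refine ⟨fun n => (L * K) * (ρ ^ 2 * x) ^ n,
    (summable_geometric_of_lt_one (by positivity) h2).mul_left _, fun s hs0 hs1 n => ?_⟩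
  have h3 := norm_P_le hK h1 hb hs0 hs1 n
  have h4 := hb2 n
  rw [poch_one] at h4
  have hxn : ‖(x : ℂ)‖ = x := by simp [abs_of_pos hx0]
  rw [norm_mul, norm_pow, hxn]
  calc _ ≤ (L * ρ ^ n * x ^ n) * (K * ρ ^ n) := by gcongr
    _ = _ := by simp only [mul_pow]; ring

lemma double_series (a b : ℂ) {c : ℂ} (h : ∀ n : ℕ, c ≠ -(n : ℂ)) {x : ℝ} (hx0 : 0 < x)
    (hx1 : x < 1) {s : ℝ} (hs0 : 0 < s) (hs1 : s < 1) :
    ((1 - x * s : ℝ) : ℂ) ^ (-b) *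
      ∑' k, hcoef a b c k * ((x * (1 - s) / (1 - x * s) : ℝ) : ℂ) ^ k = ∑' n, Qser a b c x n s := by
  obtain ⟨M, hM, hMb⟩ := Qser_bound a b h hx0 hx1
  let f : ℕ × ℕ → ℂ := fun p => poch b (p.1 + p.2) / ((p.1 + p.2).factorial : ℂ) *
    (x : ℂ) ^ (p.1 + p.2) * (((p.1 + p.2).choose p.1 : ℂ) * (poch a p.1 / poch c p.1) *
      ((1 - s : ℂ) ^ p.1 * (s : ℂ) ^ p.2))
  have hf : ∀ n, ∀ p ∈ Finset.HasAntidiagonal.antidiagonal n, f p =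
      poch b n / (n.factorial : ℂ) * (x : ℂ) ^ n * ((n.choose p.1 : ℂ) *
      (poch a p.1 / poch c p.1) * ((1 - s : ℂ) ^ p.1 * (s : ℂ) ^ p.2)) := by
    intro n p hp
    rw [← Finset.HasAntidiagonal.mem_antidiagonal.1 hp]
  obtain ⟨h1, -⟩ := antidiag_hasSum (f := f) hM (fun n => by
    refine le_trans (le_of_eq ?_) (hMb s hs0 hs1 n)
    rw [Finset.mul_sum]
    refine Finset.sum_congr rfl fun p hp => ?_
    rw [hf n p hp, norm_mul])
  have h2 : ∑' n, ∑ p ∈ Finset.HasAntidiagonal.antidiagonal n, f p = ∑' n, Qser a b c x n s := by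
    refine tsum_congr fun n => ?_
    rw [Qser, Finset.mul_sum]
    exact Finset.sum_congr rfl (hf n)
  rw [← h2, ← h1, ← tsum_mul_left]
  refine tsum_congr fun k => ?_
  have hxs : 0 < x * s := by positivity
  have hxs1 : x * s < 1 := by nlinarith
  have hnz : ((1 - x * s : ℝ) : ℂ) ≠ 0 := by
    exact_mod_cast (by linarith : (0:ℝ) < 1 - x * s).ne'
  have hb := hasSum_binom (b + k) (z := ((x * s : ℝ) : ℂ))
    (by rw [Complex.norm_real, Real.norm_eq_abs, abs_of_pos hxs]; exact hxs1)
  have e1 : (1 - ((x * s : ℝ) : ℂ)) = ((1 - x * s : ℝ) : ℂ) := by push_cast; rfl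
  rw [e1] at hb
  have e2 : ((1 - x * s : ℝ) : ℂ) ^ (-b) *
      (hcoef a b c k * ((x * (1 - s) / (1 - x * s) : ℝ) : ℂ) ^ k)
      = (hcoef a b c k * ((x : ℂ) * (1 - s)) ^ k) * ((1 - x * s : ℝ) : ℂ) ^ (-(b + k)) := by
    rw [neg_add, cpow_add _ _ hnz, cpow_neg _ (k : ℂ), cpow_natCast, Complex.ofReal_div, div_pow]
    push_cast
    field_simp
  rw [e2, ← hb.tsum_eq, ← tsum_mul_left]
  refine tsum_congr fun j => ?_
  simp only [f]
  rw [hcoef, poch_add b k j, Nat.cast_add_choose ℂ]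
  have hf0 : ∀ m : ℕ, (m.factorial : ℂ) ≠ 0 := fun m => by exact_mod_cast m.factorial_ne_zero
  have := hf0 (k + j)
  have := hf0 k
  have := hf0 j
  have := poch_ne_zero h k
  push_cast
  rw [pow_add, mul_pow, mul_pow]
  field_simp

lemma weight_integrable {c μ : ℂ} (hc : 0 < c.re) (hμ : 0 < μ.re) :
    IntegrableOn (fun s : ℝ => (s : ℂ) ^ (μ - 1) * (1 - s : ℂ) ^ (c - 1)) (Ioo 0 1) := by
  have := Complex.betaIntegral_convergent hμ hc
  rw [intervalIntegrable_iff_integrableOn_Ioo_of_le zero_le_one] at this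
  exact this

lemma beta_moment {c μ : ℂ} (hc : 0 < c.re) (hμ : 0 < μ.re) (hc1 : ∀ n : ℕ, c ≠ -(n : ℂ))
    (hc2 : ∀ n : ℕ, c + μ ≠ -(n : ℂ)) (k j : ℕ) :
    ∫ s in Ioo (0:ℝ) 1, ((s : ℂ) ^ (μ - 1) * (1 - s : ℂ) ^ (c - 1)) *
      ((1 - s : ℂ) ^ k * (s : ℂ) ^ j) =
    Complex.Gamma c * Complex.Gamma μ / Complex.Gamma (c + μ) *
      (poch c k * poch μ j / poch (c + μ) (k + j)) := by
  have hμ1 : ∀ n : ℕ, μ ≠ -(n : ℂ) := by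
    intro n hn
    rw [hn] at hμ
    simp at hμ
    have : (0:ℝ) ≤ n := Nat.cast_nonneg n
    linarith
  have hj : 0 < (μ + j).re := by simp; positivity
  have hk : 0 < (c + k).re := by simp; positivity
  have hB := Complex.Gamma_mul_Gamma_eq_betaIntegral hj hk
  have e : μ + j + (c + k) = (c + μ) + ((k + j : ℕ) : ℂ) := by push_cast; ring
  rw [e, Gamma_add_nat hμ1, Gamma_add_nat hc1, Gamma_add_nat hc2] at hB
  have hG : Complex.Gamma (c + μ) ≠ 0 := Complex.Gamma_ne_zero hc2
  have hp := poch_ne_zero hc2 (k + j)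
  have hI : ∫ s in Ioo (0:ℝ) 1, ((s : ℂ) ^ (μ - 1) * (1 - s : ℂ) ^ (c - 1)) *
      ((1 - s : ℂ) ^ k * (s : ℂ) ^ j) = Complex.betaIntegral (μ + j) (c + k) := by
    rw [Complex.betaIntegral, intervalIntegral.integral_of_le zero_le_one,
      integral_Ioc_eq_integral_Ioo]
    refine setIntegral_congr_fun measurableSet_Ioo fun s hs => ?_
    have h1 : (s : ℂ) ≠ 0 := by exact_mod_cast hs.1.ne'
    have h2 : (1 - s : ℂ) ≠ 0 := by
      have : (1 - s : ℝ) ≠ 0 := by linarith [hs.2]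
      exact_mod_cast this
    have e1 : μ + j - 1 = (μ - 1) + j := by ring
    have e2 : c + k - 1 = (c - 1) + k := by ring
    rw [e1, e2, cpow_add _ _ h1, cpow_add _ _ h2, cpow_natCast, cpow_natCast]
    ring
  rw [hI, div_mul_div_comm, eq_div_iff (mul_ne_zero hG hp)]
  linear_combination -hB

lemma integral_series {c μ : ℂ} (hc : 0 < c.re) (hμ : 0 < μ.re) {Q : ℕ → ℝ → ℂ} {M : ℕ → ℝ}
    (hM : Summable M) (hQc : ∀ n, Continuous (Q n))
    (hQ : ∀ n, ∀ s ∈ Ioo (0:ℝ) 1, ‖Q n s‖ ≤ M n) :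
    ∫ s in Ioo (0:ℝ) 1, ((s : ℂ) ^ (μ - 1) * (1 - s : ℂ) ^ (c - 1)) * ∑' n, Q n s
      = ∑' n, ∫ s in Ioo (0:ℝ) 1, ((s : ℂ) ^ (μ - 1) * (1 - s : ℂ) ^ (c - 1)) * Q n s := by
  have hw := weight_integrable hc hμ
  have hint : ∀ n, IntegrableOn
      (fun s : ℝ => ((s : ℂ) ^ (μ - 1) * (1 - s : ℂ) ^ (c - 1)) * Q n s) (Ioo 0 1) := by
    intro n
    refine Integrable.mul_bdd (c := M n) hw (hQc n).aestronglyMeasurable ?_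
    exact (ae_restrict_iff' measurableSet_Ioo).2 (Eventually.of_forall (hQ n))
  have := hasSum_integral_of_summable_integral_norm hint (by
    refine Summable.of_nonneg_of_le (fun n => integral_nonneg fun _ => norm_nonneg _) (fun n => ?_)
      (hM.mul_left (∫ s in Ioo (0:ℝ) 1, ‖(s : ℂ) ^ (μ - 1) * (1 - s : ℂ) ^ (c - 1)‖))
    rw [← integral_mul_const]
    refine setIntegral_mono_on (hint n).norm (hw.norm.mul_const _) measurableSet_Ioo
      fun s hs => ?_
    rw [norm_mul]
    exact mul_le_mul_of_nonneg_left (hQ n s hs) (norm_nonneg _))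
  rw [this.tsum_eq]
  simp only [tsum_mul_left]

lemma cpow_exp {t : ℝ} (ht : 0 < t) (z : ℂ) : (t : ℂ) ^ z = Complex.exp (z * (Real.log t : ℂ)) := by
  rw [cpow_def_of_ne_zero (by exact_mod_cast ht.ne'), Complex.ofReal_log ht.le, mul_comm]

lemma core_pos (a b : ℂ) {c μ : ℂ} (hc : 0 < c.re) (hμ : 0 < μ.re)
    (hc1 : ∀ n : ℕ, c ≠ -(n : ℂ)) (hc2 : ∀ n : ℕ, c + μ ≠ -(n : ℂ))
    {x : ℝ} (hx0 : 0 < x) (hx1 : x < 1) :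
    ∫ s in Ioo (0:ℝ) 1, ((s : ℂ) ^ (μ - 1) * (1 - s : ℂ) ^ (c - 1)) *
      (((1 - x * s : ℝ) : ℂ) ^ (-b) * hypF a b c (x * (1 - s) / (1 - x * s)))
      = Complex.Gamma c * Complex.Gamma μ / Complex.Gamma (c + μ) * hypF (a + μ) b (c + μ) x := by
  obtain ⟨M, hM, hMb⟩ := Qser_bound a b hc1 hx0 hx1
  have h1 : ∀ s ∈ Ioo (0:ℝ) 1, ((s : ℂ) ^ (μ - 1) * (1 - s : ℂ) ^ (c - 1)) *
      (((1 - x * s : ℝ) : ℂ) ^ (-b) * hypF a b c (x * (1 - s) / (1 - x * s)))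
      = ((s : ℂ) ^ (μ - 1) * (1 - s : ℂ) ^ (c - 1)) * ∑' n, Qser a b c x n s := by
    intro s hs
    have hy : 0 ≤ x * (1 - s) / (1 - x * s) := by
      have := hs.1
      have := hs.2
      apply div_nonneg <;> nlinarith
    rw [← double_series a b hc1 hx0 hx1 hs.1 hs.2, hypF, if_pos hy]
    rfl
  rw [setIntegral_congr_fun measurableSet_Ioo h1, integral_series hc hμ hM, hypF, if_pos hx0.le,
    ← tsum_mul_left]
  · refine tsum_congr fun n => ?_
    have e : ∀ s : ℝ, ((s : ℂ) ^ (μ - 1) * (1 - s : ℂ) ^ (c - 1)) * Qser a b c x n s =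
        ∑ p ∈ Finset.HasAntidiagonal.antidiagonal n,
          (poch b n / (n.factorial : ℂ) * (x : ℂ) ^ n *
            ((n.choose p.1 : ℂ) * (poch a p.1 / poch c p.1))) *
          (((s : ℂ) ^ (μ - 1) * (1 - s : ℂ) ^ (c - 1)) *
            ((1 - s : ℂ) ^ p.1 * (s : ℂ) ^ p.2)) := by
      intro s
      rw [Qser, Finset.mul_sum, Finset.mul_sum]
      exact Finset.sum_congr rfl fun p _ => by ring
    simp only [e]
    rw [integral_finsetSum]
    · simp only [integral_const_mul, beta_moment hc hμ hc1 hc2]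
      rw [← poch_vandermonde a μ n, Finset.sum_mul, Finset.sum_div, Finset.sum_mul,
        Finset.mul_sum]
      refine Finset.sum_congr rfl fun p hp => ?_
      have hpn := Finset.HasAntidiagonal.mem_antidiagonal.1 hp
      have := poch_ne_zero hc1 p.1
      have := poch_ne_zero hc2 n
      rw [hpn]
      field_simp
    · intro p _
      refine Integrable.const_mul ?_ _
      refine Integrable.mul_bdd (c := 1) (weight_integrable hc hμ) ?_ ?_
      · exact (by fun_prop : Continuous fun s : ℝ =>
          ((1 - s : ℂ) ^ p.1 * (s : ℂ) ^ p.2)).aestronglyMeasurable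
      · refine (ae_restrict_iff' measurableSet_Ioo).2 (Eventually.of_forall fun s hs => ?_)
        have h1s : ‖(1 - s : ℂ)‖ = 1 - s := by
          rw [← Complex.ofReal_one, ← Complex.ofReal_sub, Complex.norm_real, Real.norm_eq_abs,
            abs_of_pos (by linarith [hs.2])]
        have hs' : ‖(s : ℂ)‖ = s := by simp [abs_of_pos hs.1]
        rw [norm_mul, norm_pow, norm_pow, h1s, hs']
        exact mul_le_one₀ (pow_le_one₀ (by linarith [hs.2]) (by linarith [hs.1]))
          (pow_nonneg hs.1.le _) (pow_le_one₀ hs.1.le hs.2.le)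
  · intro n
    unfold Qser
    fun_prop
  · intro n s hs
    refine le_trans ?_ (hMb s hs.1 hs.2 n)
    rw [Qser, norm_mul]
    exact mul_le_mul_of_nonneg_left (norm_sum_le _ _) (norm_nonneg _)

lemma core_neg (a b : ℂ) {c μ : ℂ} (hc : 0 < c.re) (hμ : 0 < μ.re)
    (hc1 : ∀ n : ℕ, c ≠ -(n : ℂ)) (hc2 : ∀ n : ℕ, c + μ ≠ -(n : ℂ))
    {x : ℝ} (hx0 : x < 0) :
    ∫ s in Ioo (0:ℝ) 1, ((s : ℂ) ^ (μ - 1) * (1 - s : ℂ) ^ (c - 1)) *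
      (((1 - x * s : ℝ) : ℂ) ^ (-b) * hypF a b c (x * (1 - s) / (1 - x * s)))
      = Complex.Gamma c * Complex.Gamma μ / Complex.Gamma (c + μ) * hypF (a + μ) b (c + μ) x := by
  set v : ℝ := x / (x - 1) with hv
  have hx1 : 0 < 1 - x := by linarith
  have hx1' : x - 1 ≠ 0 := by linarith
  have hv0 : 0 ≤ v := div_nonneg_of_nonpos hx0.le (by linarith)
  have hv1 : v < 1 := by rw [hv, div_lt_one_of_neg (by linarith)]; linarith
  let Q : ℕ → ℝ → ℂ := fun n s => hcoef (c - a) b c n * (v : ℂ) ^ n * (1 - s : ℂ) ^ n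
  have h1 : ∀ s ∈ Ioo (0:ℝ) 1, ((s : ℂ) ^ (μ - 1) * (1 - s : ℂ) ^ (c - 1)) *
      (((1 - x * s : ℝ) : ℂ) ^ (-b) * hypF a b c (x * (1 - s) / (1 - x * s)))
      = ((1 - x : ℝ) : ℂ) ^ (-b) *
        (((s : ℂ) ^ (μ - 1) * (1 - s : ℂ) ^ (c - 1)) * ∑' n, Q n s) := by
    intro s hs
    have hxs : 0 < 1 - x * s := by nlinarith [hs.1]
    have h1s : 0 < 1 - s := by linarith [hs.2]
    have hy : ¬ 0 ≤ x * (1 - s) / (1 - x * s) :=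
      not_le.2 (div_neg_of_neg_of_pos (mul_neg_of_neg_of_pos hx0 h1s) hxs)
    have ey : 1 - x * (1 - s) / (1 - x * s) = (1 - x) / (1 - x * s) := by
      field_simp; ring
    have eu : x * (1 - s) / (1 - x * s) / (x * (1 - s) / (1 - x * s) - 1) = v * (1 - s) := by
      have : x * (1 - s) / (1 - x * s) - 1 = (x - 1) / (1 - x * s) := by
        field_simp; ring
      rw [this, hv]
      field_simp
    have e1u : 1 - v * (1 - s) = (1 - x * s) / (1 - x) := by
      rw [hv, eq_div_iff hx1.ne']
      field_simp
      ring
    have hE := euler_transf (c - a) b c hc1 (v := v * (1 - s)) (by positivity)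
      (by nlinarith [hs.1])
    rw [sub_sub_cancel, e1u] at hE
    rw [hypF, if_neg hy, ey, eu]
    change _ * (_ * (_ * ∑' k, hcoef a (c - b) c k * ((v * (1 - s) : ℝ) : ℂ) ^ k)) = _
    have hQ : ∑' n, Q n s = ∑' k, hcoef (c - a) b c k * ((v * (1 - s) : ℝ) : ℂ) ^ k := by
      refine tsum_congr fun n => ?_
      simp only [Q]
      push_cast
      rw [mul_pow]; ring
    rw [hE, hQ]
    have ee : ((1 - x * s : ℝ) : ℂ) ^ (-b) * (((1 - x) / (1 - x * s) : ℝ) : ℂ) ^ (-a) *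
        (((1 - x * s) / (1 - x) : ℝ) : ℂ) ^ (-(a - b)) = ((1 - x : ℝ) : ℂ) ^ (-b) := by
      rw [cpow_exp hxs, cpow_exp (div_pos hx1 hxs), cpow_exp (div_pos hxs hx1), cpow_exp hx1,
        Real.log_div hx1.ne' hxs.ne', Real.log_div hxs.ne' hx1.ne', ← Complex.exp_add,
        ← Complex.exp_add]
      congr 1
      push_cast
      ring
    rw [← ee]
    ring
  have hR : hypF (a + μ) b (c + μ) x
      = ((1 - x : ℝ) : ℂ) ^ (-b) * ∑' k, hcoef (c - a) b (c + μ) k * (v : ℂ) ^ k := by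
    have hE := euler_transf (c - a) b (c + μ) hc2 hv0 hv1
    have e1 : c + μ - (c - a) = a + μ := by ring
    have e1v : 1 - v = 1 / (1 - x) := by
      rw [hv, eq_div_iff hx1.ne']
      field_simp
      ring
    rw [e1, e1v] at hE
    rw [hypF, if_neg (not_le.2 hx0)]
    change _ * ∑' k, hcoef (a + μ) (c + μ - b) (c + μ) k * (v : ℂ) ^ k = _
    rw [hE, ← mul_assoc]
    congr 1
    rw [cpow_exp hx1, cpow_exp (one_div_pos.2 hx1), cpow_exp hx1, one_div, Real.log_inv,
      ← Complex.exp_add]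
    congr 1
    push_cast
    ring
  rw [setIntegral_congr_fun measurableSet_Ioo h1, integral_const_mul,
    integral_series hc hμ (hcoef_summable (c - a) b hc1 hv0 hv1), hR]
  · rw [mul_left_comm]
    congr 1
    rw [← tsum_mul_left]
    refine tsum_congr fun n => ?_
    have e : ∀ s : ℝ, ((s : ℂ) ^ (μ - 1) * (1 - s : ℂ) ^ (c - 1)) * Q n s =
        (hcoef (c - a) b c n * (v : ℂ) ^ n) * (((s : ℂ) ^ (μ - 1) * (1 - s : ℂ) ^ (c - 1)) *
            ((1 - s : ℂ) ^ n * (s : ℂ) ^ 0)) := by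
      intro s
      simp only [Q]
      ring
    simp only [e, integral_const_mul, beta_moment hc hμ hc1 hc2, add_zero, poch_zero, hcoef]
    have := poch_ne_zero hc1 n
    have := poch_ne_zero hc2 n
    field_simp
  · intro n
    simp only [Q]
    fun_prop
  · intro n s hs
    have h1s : ‖(1 - s : ℂ)‖ = 1 - s := by
      rw [← Complex.ofReal_one, ← Complex.ofReal_sub, Complex.norm_real, Real.norm_eq_abs,
        abs_of_pos (by linarith [hs.2])]
    have hvn : ‖(v : ℂ)‖ = v := by simp [abs_of_nonneg hv0]
    simp only [Q]
    rw [norm_mul, norm_mul, norm_pow, norm_pow, h1s, hvn]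
    exact mul_le_of_le_one_right (by positivity)
      (pow_le_one₀ (by linarith [hs.2]) (by linarith [hs.1]))

lemma image_subst {x : ℝ} (hx0 : x ≠ 0) (hx1 : x < 1) :
    (fun s : ℝ => x * (1 - s) / (1 - x * s)) '' Ioo 0 1 = uIoo 0 x := by
  have hpos : ∀ s ∈ Ioo (0:ℝ) 1, 0 < 1 - x * s := by
    intro s hs
    have := hs.1
    have := hs.2
    rcases lt_or_gt_of_ne hx0 with h | h <;> nlinarith
  ext y
  constructor
  · rintro ⟨s, hs, rfl⟩
    have h := hpos s hs
    have h1 : 0 < 1 - s := by linarith [hs.2]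
    have e : x - x * (1 - s) / (1 - x * s) = x * (s * (1 - x) / (1 - x * s)) := by
      field_simp; ring
    have hq : 0 < s * (1 - x) / (1 - x * s) :=
      div_pos (mul_pos hs.1 (by linarith)) h
    rcases lt_or_gt_of_ne hx0 with h0 | h0
    · rw [uIoo_of_ge h0.le]
      refine ⟨?_, div_neg_of_neg_of_pos (mul_neg_of_neg_of_pos h0 h1) h⟩
      have := mul_neg_of_neg_of_pos h0 hq
      simp only
      linarith
    · rw [uIoo_of_le h0.le]
      refine ⟨div_pos (mul_pos h0 h1) h, ?_⟩
      have := mul_pos h0 hq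
      simp only
      linarith
  · intro hy
    have hy1 : 0 < 1 - y := by
      rcases lt_or_gt_of_ne hx0 with h0 | h0
      · rw [uIoo_of_ge h0.le] at hy; linarith [hy.2]
      · rw [uIoo_of_le h0.le] at hy; linarith [hy.2]
    have hxy : 0 < (x - y) / x ∧ 0 < y / x := by
      rcases lt_or_gt_of_ne hx0 with h0 | h0
      · rw [uIoo_of_ge h0.le] at hy
        exact ⟨div_pos_of_neg_of_neg (by linarith [hy.1]) h0, div_pos_of_neg_of_neg hy.2 h0⟩
      · rw [uIoo_of_le h0.le] at hy
        exact ⟨div_pos (by linarith [hy.2]) h0, div_pos hy.1 h0⟩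
    have e1 : 1 - (x - y) / x / (1 - y) = (y / x) * (1 - x) / (1 - y) := by
      field_simp; ring
    have hs1 : 0 < 1 - (x - y) / x / (1 - y) := by
      rw [e1]; exact div_pos (mul_pos hxy.2 (by linarith)) hy1
    refine ⟨(x - y) / x / (1 - y), ⟨div_pos hxy.1 hy1, by linarith⟩, ?_⟩
    have e2 : 1 - x * ((x - y) / x / (1 - y)) = (1 - x) / (1 - y) := by
      field_simp; ring
    simp only
    rw [e1, e2]
    have : 1 - x ≠ 0 := by linarith
    field_simp

lemma uIoo_subst {x : ℝ} (hx0 : x ≠ 0) (hx1 : x < 1) (g : ℝ → ℂ) :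
    ∫ y in uIoo 0 x, g y = ∫ s in Ioo (0:ℝ) 1,
      |(-(x * (1 - x)) / (1 - x * s) ^ 2)| • g (x * (1 - s) / (1 - x * s)) := by
  have hpos : ∀ s ∈ Ioo (0:ℝ) 1, 0 < 1 - x * s := by
    intro s hs
    have := hs.1
    have := hs.2
    rcases lt_or_gt_of_ne hx0 with h | h <;> nlinarith
  rw [← image_subst hx0 hx1]
  refine integral_image_eq_integral_abs_deriv_smul measurableSet_Ioo (fun s hs => ?_) ?_ g
  · have h := (hpos s hs).ne'
    have h1 : HasDerivAt (fun s : ℝ => x * (1 - s)) (x * (-1)) s :=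
      ((hasDerivAt_id s).const_sub 1).const_mul x
    have h2 : HasDerivAt (fun s : ℝ => 1 - x * s) (-(x * 1)) s :=
      ((hasDerivAt_id s).const_mul x).const_sub 1
    have h3 := (h1.div h2 h).hasDerivWithinAt (s := Ioo 0 1)
    have e : (x * (-1) * (1 - x * s) - x * (1 - s) * (-(x * 1))) / (1 - x * s) ^ 2
        = -(x * (1 - x)) / (1 - x * s) ^ 2 := by
      congr 1
      ring
    rw [e] at h3
    exact h3
  · intro s hs t ht hst
    have h1 := (hpos s hs).ne'
    have h2 := (hpos t ht).ne'
    simp only at hst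
    rw [div_eq_div_iff h1 h2] at hst
    have h3 : x * (1 - x) * (s - t) = 0 := by linarith
    have h4 : x * (1 - x) ≠ 0 := mul_ne_zero hx0 (by linarith)
    have := (mul_eq_zero.1 h3).resolve_left h4
    linarith

/-- Fractional integral transformation of type `a+, c+`. -/
theorem stmt_1 (a b c μ : ℂ) (hc : 0 < c.re) (hμ : 0 < μ.re)
    (hc1 : ∀ n : ℕ, c ≠ -(n : ℂ)) (hc2 : ∀ n : ℕ, c + μ ≠ -(n : ℂ))
    (x : ℝ) (hx : x < 0 ∨ (0 < x ∧ x < 1)) :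
    ∫ y in uIoo 0 x,
        ((|y| : ℝ) : ℂ) ^ (c - 1) * ((1 - y : ℝ) : ℂ) ^ (b - c - μ) * hypF a b c y *
          (((|x - y| : ℝ) : ℂ) ^ (μ - 1) / Complex.Gamma μ)
      = Complex.Gamma c / Complex.Gamma (c + μ) * ((|x| : ℝ) : ℂ) ^ (c + μ - 1) *
        ((1 - x : ℝ) : ℂ) ^ (b - c) * hypF (a + μ) b (c + μ) x := by
  have hx0 : x ≠ 0 := by rcases hx with h | h <;> [exact h.ne; exact h.1.ne']
  have hx1 : x < 1 := by rcases hx with h | h <;> linarith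
  have hcore : ∫ s in Ioo (0:ℝ) 1, ((s : ℂ) ^ (μ - 1) * (1 - s : ℂ) ^ (c - 1)) *
      (((1 - x * s : ℝ) : ℂ) ^ (-b) * hypF a b c (x * (1 - s) / (1 - x * s)))
      = Complex.Gamma c * Complex.Gamma μ / Complex.Gamma (c + μ) * hypF (a + μ) b (c + μ) x := by
    rcases hx with h | h
    · exact core_neg a b hc hμ hc1 hc2 h
    · exact core_pos a b hc hμ hc1 hc2 h.1 h.2
  have hGμ : Complex.Gamma μ ≠ 0 := Complex.Gamma_ne_zero_of_re_pos hμ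
  rw [uIoo_subst hx0 hx1]
  have h1 : ∀ s ∈ Ioo (0:ℝ) 1, |(-(x * (1 - x)) / (1 - x * s) ^ 2)| •
      (((|x * (1 - s) / (1 - x * s)| : ℝ) : ℂ) ^ (c - 1) *
        ((1 - x * (1 - s) / (1 - x * s) : ℝ) : ℂ) ^ (b - c - μ) *
        hypF a b c (x * (1 - s) / (1 - x * s)) *
          (((|x - x * (1 - s) / (1 - x * s)| : ℝ) : ℂ) ^ (μ - 1) / Complex.Gamma μ))
      = (((|x| : ℝ) : ℂ) ^ (c + μ - 1) * ((1 - x : ℝ) : ℂ) ^ (b - c) / Complex.Gamma μ) *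
        (((s : ℂ) ^ (μ - 1) * (1 - s : ℂ) ^ (c - 1)) *
      (((1 - x * s : ℝ) : ℂ) ^ (-b) * hypF a b c (x * (1 - s) / (1 - x * s)))) := by
    intro s hs
    have hs0 := hs.1
    have h1s : 0 < 1 - s := by linarith [hs.2]
    have hxs : 0 < 1 - x * s := by
      rcases hx with h | h <;> nlinarith
    have h1x : 0 < 1 - x := by linarith
    have hax : 0 < |x| := abs_pos.2 hx0
    have e1 : |x * (1 - s) / (1 - x * s)| = |x| * (1 - s) / (1 - x * s) := by
      rw [abs_div, abs_mul, abs_of_pos h1s, abs_of_pos hxs]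
    have e2 : 1 - x * (1 - s) / (1 - x * s) = (1 - x) / (1 - x * s) := by
      field_simp; ring
    have e3 : |x - x * (1 - s) / (1 - x * s)| = |x| * s * (1 - x) / (1 - x * s) := by
      have : x - x * (1 - s) / (1 - x * s) = x * s * (1 - x) / (1 - x * s) := by
        field_simp; ring
      rw [this, abs_div, abs_mul, abs_mul, abs_of_pos hs0, abs_of_pos hxs, abs_of_pos h1x]
    have e4 : |(-(x * (1 - x)) / (1 - x * s) ^ 2)|
        = Real.exp (Real.log |x| + Real.log (1 - x) - 2 * Real.log (1 - x * s)) := by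
      rw [abs_div, abs_neg, abs_mul, abs_of_pos h1x, abs_of_pos (pow_pos hxs 2), Real.exp_sub,
        Real.exp_add, Real.exp_log hax, Real.exp_log h1x, two_mul, Real.exp_add,
        Real.exp_log hxs, sq]
    have e5 : (1 - s : ℂ) = ((1 - s : ℝ) : ℂ) := by push_cast; rfl
    rw [e1, e2, e3, e4, e5, Complex.real_smul, Complex.ofReal_exp, cpow_exp (by positivity),
      cpow_exp (t := (1 - x) / (1 - x * s)) (by positivity),
      cpow_exp (t := |x| * s * (1 - x) / (1 - x * s)) (by positivity), cpow_exp hax, cpow_exp h1x,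
      cpow_exp hs0, cpow_exp h1s, cpow_exp hxs,
      Real.log_div (by positivity) hxs.ne', Real.log_div h1x.ne' hxs.ne',
      Real.log_div (by positivity) hxs.ne', Real.log_mul hax.ne' h1s.ne',
      Real.log_mul (by positivity) h1x.ne', Real.log_mul hax.ne' hs0.ne']
    generalize hypF a b c (x * (1 - s) / (1 - x * s)) = F
    generalize Real.log |x| = l1
    generalize Real.log (1 - x) = l2
    generalize Real.log (1 - x * s) = l3
    generalize Real.log (1 - s) = l4
    generalize Real.log s = l5
    push_cast
    have key : Complex.exp ((l1 : ℂ) + l2 - 2 * l3) * Complex.exp ((c - 1) * (l1 + l4 - l3)) *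
        Complex.exp ((b - c - μ) * (l2 - l3)) * Complex.exp ((μ - 1) * (l1 + l5 + l2 - l3))
        = Complex.exp ((c + μ - 1) * l1) * Complex.exp ((b - c) * l2) *
          Complex.exp ((μ - 1) * l5) * Complex.exp ((c - 1) * l4) * Complex.exp (-b * l3) := by
      simp only [← Complex.exp_add]
      congr 1
      ring
    linear_combination (F / Complex.Gamma μ) * key
  rw [setIntegral_congr_fun measurableSet_Ioo h1, integral_const_mul, hcore]
  field_simp
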